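/- (Palais–Smale condition.) Suppose G is a Finsler-type energy on ℝ^n and Φ defines a regular bounded domain Ω with constant δ₀. Let (x_n) ⊂ Mf be a V⁻-Palais–Smale sequence for J at level c ∈ ℝ, i.e. J(x_n) → c and there are ε_n → 0⁺ such that dJ(x_n)[V] ≥ −ε_n for every V ∈ V⁻(x_n,Mf) with ‖V‖_* = 1. Then (x_n) has a subsequence that converges strongly in H¹ to some x ∈ Mf, i.e. x_{n_k} → x uniformly on [0,1] and ∫₀¹ ‖ẋ_{n_k} − ẋ‖² ds → 0. -/

import Mathlib

open MeasureTheory Set Filter RealInnerProductSpace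

noncomputable section

/-- Euclidean space `ℝ^n`. -/
abbrev Evec (n : ℕ) := EuclideanSpace ℝ (Fin n)

/-- An `H¹` curve on `[a,b]`: an absolutely continuous curve whose a.e. derivative is
square-integrable, encoded by a choice of (integrable, square-integrable) derivative
together with the fundamental theorem of calculus identity. -/
structure H1Curve (n : ℕ) (a b : ℝ) where
  toFun : ℝ → Evec n
  deriv : ℝ → Evec n
  deriv_integrable : IntegrableOn deriv (Icc a b)
  deriv_sq_integrable : IntegrableOn (fun s => ‖deriv s‖ ^ 2) (Icc a b)
  eq_add_integral : ∀ t ∈ Icc a b, toFun t = toFun a + ∫ s in a..t, deriv s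

/-- The partial differential `d_qG(q,v)` of `G` in the first variable. -/
def dqCLM {n : ℕ} (G : Evec n → Evec n → ℝ) (q v : Evec n) : Evec n →L[ℝ] ℝ :=
  fderiv ℝ (fun z => G z v) q

/-- The partial differential `d_vG(q,v)` of `G` in the second variable. -/
def dvCLM {n : ℕ} (G : Evec n → Evec n → ℝ) (q v : Evec n) : Evec n →L[ℝ] ℝ :=
  fderiv ℝ (fun w => G q w) v

/-- A Finsler-type energy on `ℝ^n` with constants `ℓ ≥ 1` and `α > 0`. -/
structure IsFinslerEnergy (n : ℕ) (G : Evec n → Evec n → ℝ) (ℓ α : ℝ) : Prop where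
  continuous : Continuous fun p : Evec n × Evec n => G p.1 p.2
  smooth : ContDiffOn ℝ 2 (fun p : Evec n × Evec n => G p.1 p.2) {p | p.2 ≠ 0}
  homog : ∀ (q v : Evec n) (lam : ℝ), 0 < lam → G q (lam • v) = lam ^ 2 * G q v
  one_le_ell : 1 ≤ ℓ
  alpha_pos : 0 < α
  lower : ∀ q v, (1 / ℓ) * ‖v‖ ^ 2 ≤ G q v
  upper : ∀ q v, G q v ≤ ℓ * ‖v‖ ^ 2
  dq_bound : ∀ q v, ‖dqCLM G q v‖ ≤ ℓ * (1 + ‖v‖ ^ 2)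
  dv_bound : ∀ q v, ‖dvCLM G q v‖ ≤ ℓ * (1 + ‖v‖)
  vv_convex : ∀ (q v : Evec n), v ≠ 0 → ∀ w : Evec n,
    α * ‖w‖ ^ 2 ≤ fderiv ℝ (fun u => dvCLM G q u w) v w

/-- `Φ` defines a regular bounded domain `Ω = Φ⁻¹((−∞,0))` with constant `δ₀`. -/
structure IsRegularDomain (n : ℕ) (Φ : Evec n → ℝ) (δ₀ : ℝ) : Prop where
  smooth : ContDiff ℝ 2 Φ
  nonempty : (Φ ⁻¹' Iio 0).Nonempty
  bounded : Bornology.IsBounded (Φ ⁻¹' Iio 0)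
  boundary_eq : frontier (Φ ⁻¹' Iio 0) = Φ ⁻¹' {0}
  delta0_pos : 0 < δ₀
  grad_ne_zero : ∀ q : Evec n, |Φ q| ≤ δ₀ → gradient Φ q ≠ 0
  sublevel_compact : ∀ δ ∈ Icc (0:ℝ) δ₀, IsCompact (Φ ⁻¹' Iic δ)

/-- Membership in `Mf`: curves in `Ω̄` with endpoints on `∂Ω`. -/
def MemMf {n : ℕ} (Φ : Evec n → ℝ) (x : H1Curve n 0 1) : Prop :=
  (∀ s ∈ Icc (0:ℝ) 1, Φ (x.toFun s) ≤ 0) ∧ Φ (x.toFun 0) = 0 ∧ Φ (x.toFun 1) = 0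

/-- Membership in `V⁻(x,Mf)`. -/
def MemVminus {n : ℕ} (Φ : Evec n → ℝ) (x ξ : H1Curve n 0 1) : Prop :=
  ⟪gradient Φ (x.toFun 0), ξ.toFun 0⟫ = 0 ∧
  ⟪gradient Φ (x.toFun 1), ξ.toFun 1⟫ = 0 ∧
  ∀ s ∈ Ioo (0:ℝ) 1, Φ (x.toFun s) = 0 → ⟪gradient Φ (x.toFun s), ξ.toFun s⟫ ≤ 0

/-- Membership in `W⁻(x,Mf)`: as `V⁻` but with strict inequality at interior touching points. -/
def MemWminus {n : ℕ} (Φ : Evec n → ℝ) (x ξ : H1Curve n 0 1) : Prop :=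
  MemVminus Φ x ξ ∧
  ∀ s ∈ Ioo (0:ℝ) 1, Φ (x.toFun s) = 0 → ⟪gradient Φ (x.toFun s), ξ.toFun s⟫ < 0

/-- The energy functional `J(x) = (1/2)∫₀¹ G(x,ẋ)`. -/
def energy {n : ℕ} (G : Evec n → Evec n → ℝ) (x : H1Curve n 0 1) : ℝ :=
  (1 / 2) * ∫ s in (0:ℝ)..1, G (x.toFun s) (x.deriv s)

/-- The differential `dJ(x)[ξ]`. -/
def dJ {n : ℕ} (G : Evec n → Evec n → ℝ) (x ξ : H1Curve n 0 1) : ℝ :=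
  (1 / 2) * ∫ s in (0:ℝ)..1,
    (dqCLM G (x.toFun s) (x.deriv s) (ξ.toFun s) + dvCLM G (x.toFun s) (x.deriv s) (ξ.deriv s))

/-- `x` is a `V⁻`-critical curve for `J` on `Mf`. -/
def IsVCritical {n : ℕ} (G : Evec n → Evec n → ℝ) (Φ : Evec n → ℝ) (x : H1Curve n 0 1) : Prop :=
  MemMf Φ x ∧ ∀ ξ : H1Curve n 0 1, MemVminus Φ x ξ → 0 ≤ dJ G x ξ

/-- The norm `‖ξ‖_*`. -/
def starNorm {n : ℕ} (ξ : H1Curve n 0 1) : ℝ :=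
  max ‖ξ.toFun 0‖ ‖ξ.toFun 1‖ + Real.sqrt (∫ s in (0:ℝ)..1, ‖ξ.deriv s‖ ^ 2)

/-- The distance `dist_*`. -/
def starDist {n : ℕ} (x y : H1Curve n 0 1) : ℝ :=
  max ‖x.toFun 0 - y.toFun 0‖ ‖x.toFun 1 - y.toFun 1‖ +
    Real.sqrt (∫ s in (0:ℝ)..1, ‖x.deriv s - y.deriv s‖ ^ 2)

/-- The penalization function `χ_δ`. -/
def chi (δ t : ℝ) : ℝ := if t ≤ 0 then 0 else t ^ 2 / (δ - t) ^ 2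

/-- Membership in `C_δ = C([a,b],p,q,Ω_δ)`. -/
def MemC {n : ℕ} (Φ : Evec n → ℝ) (δ a b : ℝ) (p q : Evec n) (γ : H1Curve n a b) : Prop :=
  (∀ s ∈ Icc a b, Φ (γ.toFun s) < δ) ∧ γ.toFun a = p ∧ γ.toFun b = q

/-- The penalized functional `J_δ`. -/
def Jpen {n : ℕ} (G : Evec n → Evec n → ℝ) (Φ : Evec n → ℝ) (δ a b : ℝ)
    (γ : H1Curve n a b) : ℝ :=
  (1 / 2) * (∫ s in a..b, G (γ.toFun s) (γ.deriv s)) + ∫ s in a..b, chi δ (Φ (γ.toFun s))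

/-- `y` represents the backward parametrization `ℛx` of `x` (on `[0,1]`). -/
def RevRep {n : ℕ} (x y : H1Curve n 0 1) : Prop :=
  (∀ s, y.toFun s = x.toFun (1 - s)) ∧ (∀ s, y.deriv s = -x.deriv (1 - s))


/-! ### Absolute continuity and the chain rule -/

lemma ac_of_dist_le {X Y : Type*} [PseudoMetricSpace X] [PseudoMetricSpace Y] {f : ℝ → X}
    {g : ℝ → Y} {a b : ℝ}
    (hg : AbsolutelyContinuousOnInterval g a b) (C : ℝ)
    (h : ∀ s ∈ uIcc a b, ∀ t ∈ uIcc a b, dist (f s) (f t) ≤ C * dist (g s) (g t)) :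
    AbsolutelyContinuousOnInterval f a b := by
  unfold AbsolutelyContinuousOnInterval at *
  have h2 := hg.const_mul C
  rw [mul_zero] at h2
  refine squeeze_zero' (Eventually.of_forall fun E => Finset.sum_nonneg fun i _ => dist_nonneg)
    ?_ h2
  refine Filter.mem_inf_of_right ?_
  intro E hE
  simp only [mem_ofPred_eq]
  rw [Finset.mul_sum]
  exact Finset.sum_le_sum fun i hi => h _ (hE.1 i hi).1 _ (hE.1 i hi).2

lemma ac_integral {E : Type*} [NormedAddCommGroup E] [NormedSpace ℝ E] [CompleteSpace E]
    {u : ℝ → E} (hu : IntervalIntegrable u volume 0 1) :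
    AbsolutelyContinuousOnInterval (fun t => ∫ s in (0:ℝ)..t, u s) 0 1 := by
  have h1 := hu.norm.absolutelyContinuousOnInterval_intervalIntegral (c := 0) (by simp)
  refine ac_of_dist_le h1 1 ?_
  intro s hs t ht
  have i1 : ∀ r ∈ uIcc (0:ℝ) 1, IntervalIntegrable u volume 0 r := fun r hr =>
    hu.mono_set (uIcc_subset_uIcc (by simp) hr)
  rw [dist_eq_norm, dist_eq_norm, one_mul,
    intervalIntegral.integral_interval_sub_left (i1 s hs) (i1 t ht),
    intervalIntegral.integral_interval_sub_left (i1 s hs).norm (i1 t ht).norm]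
  exact intervalIntegral.norm_integral_le_abs_integral_norm

lemma chain_rule {E F : Type*} [NormedAddCommGroup E] [NormedSpace ℝ E] [CompleteSpace E]
    [FiniteDimensional ℝ E] [NormedAddCommGroup F] [NormedSpace ℝ F] [CompleteSpace F]
    {z u : ℝ → E} (hu : IntervalIntegrable u volume 0 1)
    (hz : ∀ t ∈ Icc (0:ℝ) 1, z t = z 0 + ∫ s in (0:ℝ)..t, u s)
    {f : E → F} (hf : ContDiff ℝ 1 f)
    (hi : IntervalIntegrable (fun s => fderiv ℝ f (z s) (u s)) volume 0 1) :
    ∀ t ∈ Icc (0:ℝ) 1, f (z t) = f (z 0) + ∫ s in (0:ℝ)..t, fderiv ℝ f (z s) (u s) := by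
  have hac : AbsolutelyContinuousOnInterval z 0 1 := by
    refine ac_of_dist_le (ac_integral hu) 1 ?_
    intro s hs t ht
    rw [uIcc_of_le zero_le_one] at hs ht
    rw [hz s hs, hz t ht, dist_add_left, one_mul]
  have hK : IsCompact (z '' Icc 0 1) := by
    have := hac.continuousOn
    rw [uIcc_of_le zero_le_one] at this
    exact isCompact_Icc.image_of_continuousOn this
  obtain ⟨C, hC⟩ := (hf.locallyLipschitz.locallyLipschitzOn
    (s := z '' Icc 0 1)).exists_lipschitzOnWith_of_compact hK
  have hac2 : AbsolutelyContinuousOnInterval (fun t => f (z t)) 0 1 := by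
    refine ac_of_dist_le hac C ?_
    intro s hs t ht
    rw [uIcc_of_le zero_le_one] at hs ht
    exact hC.dist_le_mul _ (mem_image_of_mem _ hs) _ (mem_image_of_mem _ ht)
  have hac3 := hac2.sub (ac_integral hi)
  obtain ⟨c, hc⟩ := hac3.const_of_ae_hasDerivAt_zero (by
    have n0 : ∀ᵐ x : ℝ, x ≠ 0 := by simp [ae_iff, measure_singleton]
    have n1 : ∀ᵐ x : ℝ, x ≠ 1 := by simp [ae_iff, measure_singleton]
    filter_upwards [hu.ae_hasDerivAt_integral, hi.ae_hasDerivAt_integral, n0, n1]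
      with t h1 h2 h3 h4 ht
    have h1 := h1 ht 0 (by simp)
    have h2 := h2 ht 0 (by simp)
    rw [uIcc_of_le zero_le_one] at ht
    have hmem : Icc (0:ℝ) 1 ∈ nhds t :=
      Icc_mem_nhds (lt_of_le_of_ne ht.1 (Ne.symm h3)) (lt_of_le_of_ne ht.2 h4)
    have h5 : HasDerivAt z (u t) t := by
      refine (h1.const_add (z 0)).congr_of_eventuallyEq ?_
      filter_upwards [hmem] with s hs using hz s hs
    have h6 := ((hf.differentiable one_ne_zero (z t)).hasFDerivAt).comp_hasDerivAt t h5
    have h7 := h6.sub h2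
    rw [sub_self] at h7
    exact h7)
  rw [uIcc_of_le zero_le_one] at hc
  intro t ht
  have e0 := hc 0 (by simp)
  have e1 := hc t ht
  simp only [Pi.sub_apply, intervalIntegral.integral_same, sub_zero] at e0 e1
  rw [e0, ← e1]; abel

/-! ### Properties of Finsler energies -/

section Finsler

variable {n : ℕ} {G : Evec n → Evec n → ℝ} {ℓ α : ℝ}

lemma dv_smul (hG : IsFinslerEnergy n G ℓ α) (q v : Evec n) {lam : ℝ} (hl : 0 < lam) :
    dvCLM G q (lam • v) = lam • dvCLM G q v := by
  unfold dvCLM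
  have h1 := fderiv_comp_smul (𝕜 := ℝ) (f := fun w => G q w) (x := v) lam
  have h2 : (fun w => G q (lam • w)) = (lam ^ 2) • fun w => G q w := by
    funext w
    simp [hG.homog q w lam hl]
  have h3 := congrFun (fderiv_const_smul_field (𝕜 := ℝ) (f := fun w => G q w) (lam ^ 2)) v
  rw [h2, h3] at h1
  have h4 : lam • (lam • fderiv ℝ (fun w => G q w) v) =
      lam • fderiv ℝ (fun w => G q w) (lam • v) := by
    rw [← h1, smul_smul, sq]; rfl
  exact (smul_right_injective _ hl.ne' h4).symm

lemma dv_zero (hG : IsFinslerEnergy n G ℓ α) (q : Evec n) : dvCLM G q 0 = 0 := by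
  have h := dv_smul hG q 0 (lam := 2) two_pos
  rw [smul_zero, two_smul] at h
  simpa using h

lemma dv_le (hG : IsFinslerEnergy n G ℓ α) (q v : Evec n) : ‖dvCLM G q v‖ ≤ ℓ * ‖v‖ := by
  refine le_of_forall_pos_le_add fun ε hε => ?_
  have hl : 0 < ℓ := lt_of_lt_of_le one_pos hG.one_le_ell
  have h1 : 0 < ℓ / ε := by positivity
  have h := hG.dv_bound q ((ℓ / ε) • v)
  rw [dv_smul hG q v h1, norm_smul, norm_smul, Real.norm_of_nonneg h1.le] at h
  have h2 : (ℓ / ε) * ‖dvCLM G q v‖ ≤ (ℓ / ε) * (ℓ * ‖v‖ + ε) := by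
    have : (ℓ / ε) * (ℓ * ‖v‖ + ε) = ℓ * (1 + ℓ / ε * ‖v‖) := by field_simp; ring
    rw [this]; exact h
  exact le_of_mul_le_mul_left h2 h1

lemma isOpen_ne_snd : IsOpen {p : Evec n × Evec n | p.2 ≠ 0} :=
  isOpen_ne_fun continuous_snd continuous_const

lemma dv_eq (hG : IsFinslerEnergy n G ℓ α) (q v : Evec n) (hv : v ≠ 0) :
    dvCLM G q v = (fderiv ℝ (fun p : Evec n × Evec n => G p.1 p.2) (q, v)).comp
      (ContinuousLinearMap.inr ℝ (Evec n) (Evec n)) := by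
  have h1 : DifferentiableAt ℝ (fun p : Evec n × Evec n => G p.1 p.2) (q, v) :=
    ((hG.smooth.contDiffAt (isOpen_ne_snd.mem_nhds hv)).differentiableAt two_ne_zero)
  have h2 := h1.hasFDerivAt.comp v (hasFDerivAt_prodMk_right q v)
  exact h2.fderiv

lemma dv_contOn (hG : IsFinslerEnergy n G ℓ α) :
    ContinuousOn (fun p : Evec n × Evec n => dvCLM G p.1 p.2) {p | p.2 ≠ 0} := by
  have h := (hG.smooth.continuousOn_fderiv_of_isOpen isOpen_ne_snd one_le_two).clm_comp
    (continuousOn_const (c := ContinuousLinearMap.inr ℝ (Evec n) (Evec n)))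
  refine h.congr ?_
  rintro ⟨q, v⟩ hv
  exact dv_eq hG q v hv

lemma dv_unif (hG : IsFinslerEnergy n G ℓ α) {K : Set (Evec n)} (hK : IsCompact K)
    {ε : ℝ} (hε : 0 < ε) :
    ∃ δ > 0, ∀ p ∈ K, ∀ q ∈ K, dist p q < δ → ∀ v, ‖dvCLM G p v - dvCLM G q v‖ ≤ ε * ‖v‖ := by
  have hc : IsCompact (K ×ˢ Metric.sphere (0 : Evec n) 1) := hK.prod (isCompact_sphere 0 1)
  have hu := hc.uniformContinuousOn_of_continuous ((dv_contOn hG).mono (by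
    rintro ⟨p, v⟩ ⟨_, hv⟩
    exact Metric.ne_of_mem_sphere hv one_ne_zero))
  obtain ⟨δ, hδ, h⟩ := Metric.uniformContinuousOn_iff.1 hu ε hε
  refine ⟨δ, hδ, fun p hp q hq hpq v => ?_⟩
  rcases eq_or_ne v 0 with rfl | hv
  · simp [dv_zero hG]
  have hv' : 0 < ‖v‖ := norm_pos_iff.2 hv
  have hs : ‖v‖⁻¹ • v ∈ Metric.sphere (0 : Evec n) 1 := by
    simp [norm_smul, hv'.ne']
  have h1 := h (p, ‖v‖⁻¹ • v) ⟨hp, hs⟩ (q, ‖v‖⁻¹ • v) ⟨hq, hs⟩ (by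
    rw [Prod.dist_eq]; simpa using hpq)
  have e : ∀ p, dvCLM G p v = ‖v‖ • dvCLM G p (‖v‖⁻¹ • v) := by
    intro p
    rw [← dv_smul hG p _ hv', smul_smul, mul_inv_cancel₀ hv'.ne', one_smul]
  have e2 : ‖v‖ • dvCLM G p (‖v‖⁻¹ • v) - ‖v‖ • dvCLM G q (‖v‖⁻¹ • v) =
      ‖v‖ • (dvCLM G p (‖v‖⁻¹ • v) - dvCLM G q (‖v‖⁻¹ • v)) := (smul_sub _ _ _).symm
  rw [e p, e q, e2, norm_smul, norm_norm, mul_comm]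
  rw [dist_eq_norm] at h1
  gcongr

lemma dv_cont (hG : IsFinslerEnergy n G ℓ α) (q : Evec n) : Continuous fun v => dvCLM G q v := by
  rw [continuous_iff_continuousAt]
  intro v
  rcases eq_or_ne v 0 with rfl | hv
  · rw [ContinuousAt, dv_zero hG]
    refine squeeze_zero_norm (a := fun v => ℓ * ‖v‖) (dv_le hG q) ?_
    have : Continuous fun v : Evec n => ℓ * ‖v‖ := by fun_prop
    simpa using this.tendsto 0
  · have h := (dv_contOn hG).continuousAt (x := (q, v)) (isOpen_ne_snd.mem_nhds hv)
    exact h.comp (f := fun v => (q, v)) (by fun_prop)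

lemma dv_diff (hG : IsFinslerEnergy n G ℓ α) (q v w : Evec n) (hv : v ≠ 0) :
    DifferentiableAt ℝ (fun u => dvCLM G q u w) v := by
  have h1 : ContDiffAt ℝ 2 (fun p : Evec n × Evec n => G p.1 p.2) (q, v) :=
    hG.smooth.contDiffAt (isOpen_ne_snd.mem_nhds hv)
  have h2 : ContDiffAt ℝ 2 (fun u => G q u) v :=
    h1.comp v (f := fun u => (q, u)) (by fun_prop)
  have h3 : ContDiffAt ℝ 1 (fderiv ℝ (fun u => G q u)) v := h2.fderiv_right (by norm_num)
  exact (h3.differentiableAt one_ne_zero).clm_apply (differentiableAt_const w)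

lemma dv_mono (hG : IsFinslerEnergy n G ℓ α) (q a b : Evec n) :
    α * ‖a - b‖ ^ 2 ≤ (dvCLM G q a - dvCLM G q b) (a - b) := by
  rcases eq_or_ne a b with rfl | hab
  · simp
  have hw : a - b ≠ 0 := sub_ne_zero.2 hab
  set w := a - b with hwdef
  set h : ℝ → ℝ := fun t => dvCLM G q (b + t • w) w - t * (α * ‖w‖ ^ 2) with hh
  have hcont : Continuous h := by
    have : Continuous fun t : ℝ => dvCLM G q (b + t • w) := (dv_cont hG q).comp (by fun_prop)
    fun_prop
  have hder : ∀ t : ℝ, b + t • w ≠ 0 → DifferentiableAt ℝ h t ∧ 0 ≤ deriv h t := by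
    intro t ht
    have h1 : HasDerivAt (fun t : ℝ => b + t • w) w t := by
      simpa using ((hasDerivAt_id t).smul_const w).const_add b
    have h2 := (dv_diff hG q _ w ht).hasFDerivAt.comp_hasDerivAt t h1
    have h3 : HasDerivAt h _ t := h2.sub ((hasDerivAt_id t).mul_const (α * ‖w‖ ^ 2))
    refine ⟨h3.differentiableAt, ?_⟩
    rw [h3.deriv]
    have := hG.vv_convex q _ ht w
    linarith
  have huniq : ∀ s t : ℝ, b + s • w = 0 → b + t • w = 0 → s = t := by
    intro s t hs ht
    have : s • w = t • w := add_left_cancel (hs.trans ht.symm)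
    exact smul_left_injective ℝ hw this
  have key : ∀ c d : ℝ, c ≤ d → (∀ t ∈ Ioo c d, b + t • w ≠ 0) → h c ≤ h d := by
    intro c d hcd hne
    have hm : MonotoneOn h (Icc c d) := by
      refine monotoneOn_of_deriv_nonneg (convex_Icc c d) hcont.continuousOn ?_ ?_
      · intro t ht
        rw [interior_Icc] at ht
        exact (hder t (hne t ht)).1.differentiableWithinAt
      · intro t ht
        rw [interior_Icc] at ht
        exact (hder t (hne t ht)).2
    exact hm (left_mem_Icc.2 hcd) (right_mem_Icc.2 hcd) hcd
  have h01 : h 0 ≤ h 1 := by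
    by_cases hz : ∃ t ∈ Ioo (0:ℝ) 1, b + t • w = 0
    · obtain ⟨t, ht, htz⟩ := hz
      refine (key 0 t ht.1.le ?_).trans (key t 1 ht.2.le ?_)
      · intro s hs hsz
        exact hs.2.ne (huniq s t hsz htz)
      · intro s hs hsz
        exact hs.1.ne (huniq t s htz hsz)
    · push Not at hz
      exact key 0 1 zero_le_one hz
  have ea : b + w = a := by rw [hwdef]; abel
  simp only [hh, zero_smul, add_zero, zero_mul, sub_zero, one_smul, one_mul, ea] at h01
  simp only [sub_apply]
  linarith

end Finsler

/-! ### The correction term -/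

section Correction

variable {n : ℕ} {Φ : Evec n → ℝ} {δ₀ : ℝ}

/-- The first order remainder of `Φ`. -/
def Rm (Φ : Evec n → ℝ) (p : Evec n × Evec n) : ℝ :=
  fderiv ℝ Φ p.1 (p.2 - p.1) - (Φ p.2 - Φ p.1)

/-- A normal field. -/
def Nm (Φ : Evec n → ℝ) (q : Evec n) : Evec n :=
  (‖gradient Φ q‖ ^ 2 + Φ q ^ 2)⁻¹ • gradient Φ q

/-- The correction term. -/
def Pm (Φ : Evec n → ℝ) (p : Evec n × Evec n) : Evec n := Rm Φ p • Nm Φ p.1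

lemma denom_pos (hΦ : IsRegularDomain n Φ δ₀) (q : Evec n) :
    0 < ‖gradient Φ q‖ ^ 2 + Φ q ^ 2 := by
  by_cases h : Φ q = 0
  · have := hΦ.grad_ne_zero q (by rw [h, abs_zero]; exact hΦ.delta0_pos.le)
    have := norm_pos_iff.2 this
    positivity
  · positivity

lemma inner_gradient (q w : Evec n) : ⟪gradient Φ q, w⟫ = fderiv ℝ Φ q w := by
  simp [gradient]

lemma fderiv_contDiff (hΦ : IsRegularDomain n Φ δ₀) : ContDiff ℝ 1 (fderiv ℝ Φ) :=
  hΦ.smooth.fderiv_right (by norm_num)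

lemma gradient_contDiff (hΦ : IsRegularDomain n Φ δ₀) : ContDiff ℝ 1 (gradient Φ) := by
  have h := fderiv_contDiff hΦ
  unfold gradient
  exact (InnerProductSpace.toDual ℝ (Evec n)).symm.contDiff.comp h

lemma Nm_contDiff (hΦ : IsRegularDomain n Φ δ₀) : ContDiff ℝ 1 (Nm Φ) := by
  have h1 := gradient_contDiff hΦ
  have h2 : ContDiff ℝ 1 Φ := hΦ.smooth.of_le one_le_two
  unfold Nm
  exact (((h1.norm_sq ℝ).add (h2.pow 2)).inv fun q => (denom_pos hΦ q).ne').smul h1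

lemma Rm_contDiff (hΦ : IsRegularDomain n Φ δ₀) : ContDiff ℝ 1 (Rm Φ) := by
  have h1 := fderiv_contDiff hΦ
  have h2 : ContDiff ℝ 1 Φ := hΦ.smooth.of_le one_le_two
  unfold Rm
  exact ((h1.comp contDiff_fst).clm_apply (contDiff_snd.sub contDiff_fst)).sub
    ((h2.comp contDiff_snd).sub (h2.comp contDiff_fst))

lemma Pm_contDiff (hΦ : IsRegularDomain n Φ δ₀) : ContDiff ℝ 1 (Pm Φ) :=
  (Rm_contDiff hΦ).smul ((Nm_contDiff hΦ).comp contDiff_fst)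

lemma Pm_diag (q : Evec n) : Pm Φ (q, q) = 0 := by
  simp [Pm, Rm]

lemma Rm_deriv_diag (hΦ : IsRegularDomain n Φ δ₀) (q : Evec n) :
    HasFDerivAt (Rm Φ) (0 : Evec n × Evec n →L[ℝ] ℝ) (q, q) := by
  have h1 : HasFDerivAt (fun p : Evec n × Evec n => fderiv ℝ Φ p.1) _ (q, q) :=
    (((fderiv_contDiff hΦ).differentiable one_ne_zero).comp differentiable_fst (q, q)).hasFDerivAt
  have h2 : HasFDerivAt Φ (fderiv ℝ Φ q) q :=
    (hΦ.smooth.differentiable two_ne_zero q).hasFDerivAt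
  have h3 : HasFDerivAt (fun p : Evec n × Evec n => p.2 - p.1) _ (q, q) :=
    (hasFDerivAt_snd (𝕜 := ℝ) (p := (q, q))).sub (hasFDerivAt_fst (𝕜 := ℝ) (p := (q, q)))
  have h4 : HasFDerivAt (fun p : Evec n × Evec n => Φ p.2 - Φ p.1) _ (q, q) :=
    (h2.comp (q, q) (hasFDerivAt_snd (p := (q, q)))).sub
      (h2.comp (q, q) (hasFDerivAt_fst (p := (q, q))))
  have h5 := (h1.clm_apply h3).sub h4
  refine h5.congr_fderiv ?_
  ext w <;> simp

lemma Pm_deriv_diag (hΦ : IsRegularDomain n Φ δ₀) (q : Evec n) :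
    fderiv ℝ (Pm Φ) (q, q) = 0 := by
  have h1 : HasFDerivAt (fun p : Evec n × Evec n => Nm Φ p.1) _ (q, q) :=
    (((Nm_contDiff hΦ).differentiable one_ne_zero).comp differentiable_fst (q, q)).hasFDerivAt
  have h2 : HasFDerivAt (Pm Φ) _ (q, q) := (Rm_deriv_diag hΦ q).smul h1
  rw [h2.fderiv]
  ext w <;> simp [Rm]

lemma Pm_unif (hΦ : IsRegularDomain n Φ δ₀) {K : Set (Evec n)} (hK : IsCompact K)
    {ε : ℝ} (hε : 0 < ε) :
    ∃ δ > 0, ∀ p ∈ K, ∀ q ∈ K, dist p q < δ →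
      ‖Pm Φ (p, q)‖ ≤ ε ∧ ‖fderiv ℝ (Pm Φ) (p, q)‖ ≤ ε := by
  have hc : IsCompact (K ×ˢ K) := hK.prod hK
  have hu1 := hc.uniformContinuousOn_of_continuous (Pm_contDiff hΦ).continuous.continuousOn
  have hu2 := hc.uniformContinuousOn_of_continuous
    ((Pm_contDiff hΦ).continuous_fderiv one_ne_zero).continuousOn
  obtain ⟨δ₁, hδ₁, h1⟩ := Metric.uniformContinuousOn_iff.1 hu1 ε hε
  obtain ⟨δ₂, hδ₂, h2⟩ := Metric.uniformContinuousOn_iff.1 hu2 ε hε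
  refine ⟨min δ₁ δ₂, lt_min hδ₁ hδ₂, fun p hp q hq hpq => ?_⟩
  have hd : dist (p, q) (p, p) = dist p q := by
    rw [Prod.dist_eq, dist_comm q p]; simp
  have k1 := h1 (p, q) ⟨hp, hq⟩ (p, p) ⟨hp, hp⟩ (by rw [hd]; exact hpq.trans_le (min_le_left _ _))
  have k2 := h2 (p, q) ⟨hp, hq⟩ (p, p) ⟨hp, hp⟩ (by rw [hd]; exact hpq.trans_le (min_le_right _ _))
  rw [Pm_diag, dist_zero_right] at k1
  rw [Pm_deriv_diag hΦ, dist_zero_right] at k2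
  exact ⟨k1.le, k2.le⟩

/-- At boundary points, the corrected variation has normal component `Φ q`. -/
lemma inner_corr (hΦ : IsRegularDomain n Φ δ₀) (p q : Evec n) (hp : Φ p = 0) :
    ⟪gradient Φ p, (q - p) - Pm Φ (p, q)⟫ = Φ q := by
  have hd := (denom_pos hΦ p).ne'
  have h1 : ⟪gradient Φ p, Nm Φ p⟫ = (1:ℝ) := by
    rw [Nm, inner_smul_right, real_inner_self_eq_norm_sq]
    rw [hp] at hd ⊢
    simp only [ne_eq, OfNat.ofNat_ne_zero, not_false_eq_true, zero_pow, add_zero] at hd ⊢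
    exact inv_mul_cancel₀ hd
  rw [inner_sub_right, Pm, inner_smul_right, h1, inner_gradient, Rm, hp]
  ring

end Correction

/-! ### Curves -/

/-- Lebesgue measure on the unit interval. -/
abbrev muI : Measure ℝ := volume.restrict (Icc (0:ℝ) 1)

lemma int01 {E : Type*} [NormedAddCommGroup E] [NormedSpace ℝ E] (f : ℝ → E) :
    ∫ s in (0:ℝ)..1, f s = ∫ s, f s ∂muI := by
  rw [intervalIntegral.integral_of_le zero_le_one, ← integral_Icc_eq_integral_Ioc]

lemma ii01 {E : Type*} [NormedAddCommGroup E] {f : ℝ → E} (hf : Integrable f muI) :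
    IntervalIntegrable f volume 0 1 := by
  rw [intervalIntegrable_iff_integrableOn_Ioc_of_le zero_le_one]
  exact IntegrableOn.mono_set hf Ioc_subset_Icc_self

lemma ae_memI : ∀ᵐ s ∂muI, s ∈ Icc (0:ℝ) 1 := ae_restrict_mem measurableSet_Icc

section Curves

variable {n : ℕ} {G : Evec n → Evec n → ℝ} {ℓ α : ℝ} {Φ : Evec n → ℝ} {δ₀ : ℝ}

lemma H1Curve.intble (x : H1Curve n 0 1) : Integrable x.deriv muI := x.deriv_integrable

lemma H1Curve.sq_intble (x : H1Curve n 0 1) : Integrable (fun s => ‖x.deriv s‖ ^ 2) muI :=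
  x.deriv_sq_integrable

lemma H1Curve.memLp (x : H1Curve n 0 1) : MemLp x.deriv 2 muI :=
  (memLp_two_iff_integrable_sq_norm x.intble.1).2 x.sq_intble

lemma H1Curve.contOn (x : H1Curve n 0 1) : ContinuousOn x.toFun (Icc 0 1) := by
  have h := (ac_integral (ii01 x.intble)).continuousOn
  rw [uIcc_of_le zero_le_one] at h
  exact (continuousOn_const.add h).congr x.eq_add_integral

lemma H1Curve.aesm (x : H1Curve n 0 1) : AEStronglyMeasurable x.toFun muI :=
  x.contOn.aestronglyMeasurable measurableSet_Icc

lemma aesm_clm {E F : Type*} [NormedAddCommGroup E] [NormedSpace ℝ E] [NormedAddCommGroup F]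
    [NormedSpace ℝ F] {f : ℝ → E →L[ℝ] F} {g : ℝ → E} (hf : AEStronglyMeasurable f muI)
    (hg : AEStronglyMeasurable g muI) : AEStronglyMeasurable (fun s => f s (g s)) muI :=
  ContinuousLinearMap.aestronglyMeasurable_comp₂ (ContinuousLinearMap.id ℝ (E →L[ℝ] F)) hf hg

/-- Scaling of a curve. -/
def H1Curve.scale (c : ℝ) (x : H1Curve n 0 1) : H1Curve n 0 1 where
  toFun s := c • x.toFun s
  deriv s := c • x.deriv s
  deriv_integrable := x.intble.smul c
  deriv_sq_integrable := by
    have := x.sq_intble.const_mul (‖c‖ ^ 2)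
    refine this.congr (Eventually.of_forall fun s => ?_)
    simp only [norm_smul, mul_pow]
  eq_add_integral t ht := by
    rw [x.eq_add_integral t ht, smul_add, intervalIntegral.integral_smul]

lemma exists_corrected (hΦ : IsRegularDomain n Φ δ₀) (x y : H1Curve n 0 1) :
    ∃ V : H1Curve n 0 1,
      (∀ s, V.toFun s = (y.toFun s - x.toFun s) - Pm Φ (x.toFun s, y.toFun s)) ∧
      (∀ s, V.deriv s = (y.deriv s - x.deriv s) -
        fderiv ℝ (Pm Φ) (x.toFun s, y.toFun s) (x.deriv s, y.deriv s)) := by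
  set f : Evec n × Evec n → Evec n := fun p => (p.2 - p.1) - Pm Φ p with hf
  have hfc : ContDiff ℝ 1 f := (contDiff_snd.sub contDiff_fst).sub (Pm_contDiff hΦ)
  set z : ℝ → Evec n × Evec n := fun s => (x.toFun s, y.toFun s) with hz
  set u : ℝ → Evec n × Evec n := fun s => (x.deriv s, y.deriv s) with hu
  have hfd : ∀ p w, fderiv ℝ f p w = (w.2 - w.1) - fderiv ℝ (Pm Φ) p w := by
    intro p w
    have h1 : HasFDerivAt (Pm Φ) (fderiv ℝ (Pm Φ) p) p :=
      ((Pm_contDiff hΦ).differentiable one_ne_zero p).hasFDerivAt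
    have h2 : HasFDerivAt f _ p :=
      ((hasFDerivAt_snd (p := p)).sub (hasFDerivAt_fst (p := p))).sub h1
    rw [h2.fderiv]; simp
  have hzc : ContinuousOn z (Icc 0 1) := x.contOn.prodMk y.contOn
  have hui : Integrable u muI := x.intble.prodMk y.intble
  have hum : MemLp u 2 muI := by
    rw [memLp_two_iff_integrable_sq_norm hui.1]
    refine (x.sq_intble.add y.sq_intble).mono' (hui.1.norm.pow 2) (Eventually.of_forall fun s => ?_)
    rw [Real.norm_of_nonneg (by positivity)]
    simp only [hu, Prod.norm_def, Pi.add_apply]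
    rcases max_cases ‖x.deriv s‖ ‖y.deriv s‖ with h | h <;> rw [h.1] <;> nlinarith [sq_nonneg ‖x.deriv s‖, sq_nonneg ‖y.deriv s‖]
  have hDc : ContinuousOn (fun s => fderiv ℝ f (z s)) (Icc 0 1) :=
    (hfc.continuous_fderiv one_ne_zero).comp_continuousOn hzc
  obtain ⟨C, hC⟩ := isCompact_Icc.exists_bound_of_continuousOn hDc
  have hDm : AEStronglyMeasurable (fun s => fderiv ℝ f (z s) (u s)) muI :=
    aesm_clm (hDc.aestronglyMeasurable measurableSet_Icc) hui.1
  have hDL : MemLp (fun s => fderiv ℝ f (z s) (u s)) 2 muI := by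
    refine hum.of_le_mul (c := C) hDm ?_
    filter_upwards [ae_memI] with s hs
    exact (ContinuousLinearMap.le_opNorm _ _).trans
      (mul_le_mul_of_nonneg_right (hC s hs) (norm_nonneg _))
  have hDi : Integrable (fun s => fderiv ℝ f (z s) (u s)) muI := hDL.integrable one_le_two
  have hze : ∀ t ∈ Icc (0:ℝ) 1, z t = z 0 + ∫ s in (0:ℝ)..t, u s := by
    intro t ht
    have hi : IntervalIntegrable u volume 0 t :=
      (ii01 hui).mono_set (uIcc_subset_uIcc (by simp) (by rwa [uIcc_of_le zero_le_one]))
    have e1 := (ContinuousLinearMap.fst ℝ (Evec n) (Evec n)).intervalIntegral_comp_comm hi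
    have e2 := (ContinuousLinearMap.snd ℝ (Evec n) (Evec n)).intervalIntegral_comp_comm hi
    refine Prod.ext ?_ ?_
    · exact (x.eq_add_integral t ht).trans (congrArg (x.toFun 0 + ·) e1)
    · exact (y.eq_add_integral t ht).trans (congrArg (y.toFun 0 + ·) e2)
  refine ⟨⟨fun s => f (z s), fun s => fderiv ℝ f (z s) (u s), hDi,
    (memLp_two_iff_integrable_sq_norm hDm).1 hDL, chain_rule (ii01 hui) hze hfc (ii01 hDi)⟩,
    fun s => rfl, fun s => ?_⟩
  exact hfd _ _

lemma dv_meas (hG : IsFinslerEnergy n G ℓ α) (x : H1Curve n 0 1) :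
    AEStronglyMeasurable (fun s => dvCLM G (x.toFun s) (x.deriv s)) muI := by
  have h : Measurable fun p : Evec n × Evec n => fderiv ℝ (G p.1) p.2 :=
    measurable_fderiv_with_param ℝ hG.continuous
  exact (h.comp_aemeasurable
    (x.aesm.aemeasurable.prodMk x.intble.1.aemeasurable)).aestronglyMeasurable

lemma dq_meas (hG : IsFinslerEnergy n G ℓ α) (x : H1Curve n 0 1) :
    AEStronglyMeasurable (fun s => dqCLM G (x.toFun s) (x.deriv s)) muI := by
  have h : Measurable fun p : Evec n × Evec n => fderiv ℝ ((fun v z => G z v) p.1) p.2 :=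
    measurable_fderiv_with_param ℝ (f := fun v z => G z v)
      (hG.continuous.comp continuous_swap)
  exact (h.comp_aemeasurable
    (x.intble.1.aemeasurable.prodMk x.aesm.aemeasurable)).aestronglyMeasurable

lemma dJ_intble (hG : IsFinslerEnergy n G ℓ α) (x ξ : H1Curve n 0 1) :
    Integrable (fun s => dqCLM G (x.toFun s) (x.deriv s) (ξ.toFun s) +
      dvCLM G (x.toFun s) (x.deriv s) (ξ.deriv s)) muI := by
  obtain ⟨C, hC⟩ := isCompact_Icc.exists_bound_of_continuousOn ξ.contOn
  have hl : 0 < ℓ := lt_of_lt_of_le one_pos hG.one_le_ell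
  refine Integrable.add ?_ ?_
  · refine (((integrable_const (1:ℝ)).add x.sq_intble).const_mul (ℓ * C)).mono'
      (aesm_clm (dq_meas hG x) ξ.aesm) ?_
    filter_upwards [ae_memI] with s hs
    refine (ContinuousLinearMap.le_opNorm _ _).trans ?_
    have h1 := hG.dq_bound (x.toFun s) (x.deriv s)
    calc _ ≤ (ℓ * (1 + ‖x.deriv s‖ ^ 2)) * C := by
          gcongr
          exact hC s hs
      _ = _ := by simp only [Pi.add_apply]; ring
  · refine ((x.sq_intble.add ξ.sq_intble).const_mul ℓ).mono'
      (aesm_clm (dv_meas hG x) ξ.intble.1) (Eventually.of_forall fun s => ?_)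
    refine (ContinuousLinearMap.le_opNorm _ _).trans ?_
    have h1 := dv_le hG (x.toFun s) (x.deriv s)
    calc _ ≤ (ℓ * ‖x.deriv s‖) * ‖ξ.deriv s‖ := by gcongr
      _ = ℓ * (‖x.deriv s‖ * ‖ξ.deriv s‖) := by ring
      _ ≤ _ := by
        simp only [Pi.add_apply]
        gcongr
        nlinarith [sq_nonneg (‖x.deriv s‖ - ‖ξ.deriv s‖), sq_nonneg ‖x.deriv s‖,
          sq_nonneg ‖ξ.deriv s‖]

lemma energy_bound (hG : IsFinslerEnergy n G ℓ α) (x : H1Curve n 0 1) :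
    ∫ s, ‖x.deriv s‖ ^ 2 ∂muI ≤ 2 * ℓ * energy G x := by
  have hl : 0 < ℓ := lt_of_lt_of_le one_pos hG.one_le_ell
  have hi : Integrable (fun s => G (x.toFun s) (x.deriv s)) muI := by
    refine (x.sq_intble.const_mul ℓ).mono'
      (hG.continuous.comp_aestronglyMeasurable (x.aesm.prodMk x.intble.1))
      (Eventually.of_forall fun s => ?_)
    rw [Real.norm_of_nonneg]
    · exact hG.upper _ _
    · exact le_trans (by positivity) (hG.lower _ _)
  unfold energy
  rw [int01]
  have : 2 * ℓ * (1 / 2 * ∫ s, G (x.toFun s) (x.deriv s) ∂muI) =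
      ∫ s, ℓ * G (x.toFun s) (x.deriv s) ∂muI := by
    rw [integral_const_mul]; ring
  rw [this]
  refine integral_mono x.sq_intble (hi.const_mul ℓ) fun s => ?_
  have h := mul_le_mul_of_nonneg_left (hG.lower (x.toFun s) (x.deriv s)) hl.le
  rw [← mul_assoc, mul_one_div_cancel hl.ne', one_mul] at h
  exact h

lemma ps_scaled (x : H1Curve n 0 1) {ε : ℝ}
    (h : ∀ V : H1Curve n 0 1, MemVminus Φ x V → starNorm V = 1 → -ε ≤ dJ G x V)
    (V : H1Curve n 0 1) (hV : MemVminus Φ x V) : -(ε * starNorm V) ≤ dJ G x V := by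
  have hnn : 0 ≤ starNorm V := add_nonneg (le_max_of_le_left (norm_nonneg _)) (Real.sqrt_nonneg _)
  rcases hnn.eq_or_lt with h0 | hpos
  · have h1 : 0 ≤ max ‖V.toFun 0‖ ‖V.toFun 1‖ := le_max_of_le_left (norm_nonneg _)
    have h2 := Real.sqrt_nonneg (∫ s in (0:ℝ)..1, ‖V.deriv s‖ ^ 2)
    unfold starNorm at h0
    have h3 : max ‖V.toFun 0‖ ‖V.toFun 1‖ = 0 := by linarith
    have h4 : Real.sqrt (∫ s in (0:ℝ)..1, ‖V.deriv s‖ ^ 2) = 0 := by linarith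
    have h5 : ∫ s, ‖V.deriv s‖ ^ 2 ∂muI = 0 := by
      rw [Real.sqrt_eq_zero', int01] at h4
      exact le_antisymm h4 (integral_nonneg fun s => by positivity)
    have h6 : ∀ᵐ s ∂muI, V.deriv s = 0 := by
      rw [integral_eq_zero_iff_of_nonneg (fun s => by positivity) V.sq_intble] at h5
      filter_upwards [h5] with s hs
      simpa using hs
    have h7 : V.toFun 0 = 0 := by
      rw [← norm_le_zero_iff]; exact (le_max_left _ _).trans h3.le
    have h8 : ∀ t ∈ Icc (0:ℝ) 1, V.toFun t = 0 := by
      intro t ht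
      rw [V.eq_add_integral t ht, h7, zero_add]
      rw [intervalIntegral.integral_of_le ht.1]
      refine integral_eq_zero_of_ae ?_
      exact ae_restrict_of_ae_restrict_of_subset
        ((Ioc_subset_Icc_self).trans (Icc_subset_Icc_right ht.2)) h6
    have h9 : dJ G x V = 0 := by
      unfold dJ
      rw [int01, integral_eq_zero_of_ae, mul_zero]
      filter_upwards [h6, ae_memI] with s hs hsI
      simp [hs, h8 s hsI]
    rw [h9]
    unfold starNorm
    rw [← h0]; simp
  · set c := (starNorm V)⁻¹ with hc
    have hcp : 0 < c := inv_pos.2 hpos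
    have hs : starNorm (V.scale c) = 1 := by
      have : starNorm (V.scale c) = c * starNorm V := by
        unfold starNorm H1Curve.scale
        simp only [norm_smul, Real.norm_of_nonneg hcp.le, mul_pow]
        rw [intervalIntegral.integral_const_mul, Real.sqrt_mul (by positivity),
          Real.sqrt_sq hcp.le, ← mul_max_of_nonneg _ _ hcp.le]
        ring
      rw [this, hc, inv_mul_cancel₀ hpos.ne']
    have hm : MemVminus Φ x (V.scale c) := by
      obtain ⟨a1, a2, a3⟩ := hV
      refine ⟨?_, ?_, fun s hs h0 => ?_⟩
      · simp only [H1Curve.scale, inner_smul_right, a1, mul_zero]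
      · simp only [H1Curve.scale, inner_smul_right, a2, mul_zero]
      · simp only [H1Curve.scale, inner_smul_right]
        exact mul_nonpos_of_nonneg_of_nonpos hcp.le (a3 s hs h0)
    have hd : dJ G x (V.scale c) = c * dJ G x V := by
      unfold dJ H1Curve.scale
      simp only [map_smul, smul_eq_mul, ← mul_add]
      rw [intervalIntegral.integral_const_mul]
      ring
    have := h _ hm hs
    rw [hd] at this
    have h2 := mul_le_mul_of_nonneg_left this hpos.le
    rw [← mul_assoc, hc, mul_inv_cancel₀ hpos.ne', one_mul] at h2
    linarith

end Curves

/-! ### The main estimate -/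

section Main

variable {n : ℕ} {G : Evec n → Evec n → ℝ} {ℓ α : ℝ} {Φ : Evec n → ℝ} {δ₀ : ℝ}

lemma clm_le (L : Evec n →L[ℝ] ℝ) (w : Evec n) : L w ≤ ‖L‖ * ‖w‖ :=
  (le_abs_self _).trans (L.le_opNorm w)

lemma clm_neg_le (L : Evec n →L[ℝ] ℝ) (w : Evec n) : -(L w) ≤ ‖L‖ * ‖w‖ :=
  (neg_le_abs _).trans (L.le_opNorm w)

lemma pointwise_est (hG : IsFinslerEnergy n G ℓ α) {ε : ℝ} (hε : 0 < ε) (p q a b : Evec n)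
    (P₁ P₂ : Evec n) (D₁ D₂ : Evec n × Evec n →L[ℝ] Evec n)
    (hpq : ‖p - q‖ ≤ ε) (hP₁ : ‖P₁‖ ≤ ε) (hP₂ : ‖P₂‖ ≤ ε) (hD₁ : ‖D₁‖ ≤ ε) (hD₂ : ‖D₂‖ ≤ ε)
    (hdv : ‖dvCLM G p b - dvCLM G q b‖ ≤ ε * ‖b‖) :
    (dqCLM G p a ((q - p) - P₁) + dvCLM G p a ((b - a) - D₁ (a, b))) +
    (dqCLM G q b ((p - q) - P₂) + dvCLM G q b ((a - b) - D₂ (b, a))) ≤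
      8 * ℓ * ε * (1 + ‖a‖ ^ 2 + ‖b‖ ^ 2) - α * ‖a - b‖ ^ 2 := by
  have hl1 := hG.one_le_ell
  have hl : 0 < ℓ := lt_of_lt_of_le one_pos hl1
  have hA := norm_nonneg a
  have hB := norm_nonneg b
  have t1 : dqCLM G p a ((q - p) - P₁) ≤ ℓ * (1 + ‖a‖ ^ 2) * (2 * ε) := by
    refine (clm_le _ _).trans ?_
    gcongr
    · exact hG.dq_bound p a
    · refine (norm_sub_le _ _).trans ?_
      rw [norm_sub_rev q p]; linarith
  have t2 : dqCLM G q b ((p - q) - P₂) ≤ ℓ * (1 + ‖b‖ ^ 2) * (2 * ε) := by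
    refine (clm_le _ _).trans ?_
    gcongr
    · exact hG.dq_bound q b
    · refine (norm_sub_le _ _).trans ?_
      linarith
  have nab : ‖(a, b)‖ ≤ ‖a‖ + ‖b‖ := by
    rw [Prod.norm_def]; exact max_le (by simp) (by simp)
  have nba : ‖(b, a)‖ ≤ ‖a‖ + ‖b‖ := by
    rw [Prod.norm_def]; exact max_le (by simp) (by simp)
  have t3 : -(dvCLM G p a (D₁ (a, b))) ≤ ℓ * ‖a‖ * (ε * (‖a‖ + ‖b‖)) := by
    refine (clm_neg_le _ _).trans ?_
    gcongr
    · exact dv_le hG p a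
    · refine (ContinuousLinearMap.le_opNorm _ _).trans ?_
      gcongr
  have t4 : -(dvCLM G q b (D₂ (b, a))) ≤ ℓ * ‖b‖ * (ε * (‖a‖ + ‖b‖)) := by
    refine (clm_neg_le _ _).trans ?_
    gcongr
    · exact dv_le hG q b
    · refine (ContinuousLinearMap.le_opNorm _ _).trans ?_
      gcongr
  have t5 := dv_mono hG p a b
  have t6 : -((dvCLM G p b - dvCLM G q b) (a - b)) ≤ ε * ‖b‖ * (‖a‖ + ‖b‖) := by
    refine (clm_neg_le _ _).trans ?_
    gcongr
    exact norm_sub_le _ _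
  have e1 : b - a = -(a - b) := by abel
  rw [map_sub (dvCLM G p a), map_sub (dvCLM G q b), e1, map_neg]
  simp only [sub_apply] at t5 t6
  have f1 : ε * ‖b‖ * (‖a‖ + ‖b‖) ≤ 2 * ε * ℓ * (‖a‖ ^ 2 + ‖b‖ ^ 2) := by
    have : ‖b‖ * (‖a‖ + ‖b‖) ≤ 2 * (‖a‖ ^ 2 + ‖b‖ ^ 2) := by
      nlinarith [sq_nonneg (‖a‖ - ‖b‖), sq_nonneg ‖a‖]
    calc ε * ‖b‖ * (‖a‖ + ‖b‖) = ε * (‖b‖ * (‖a‖ + ‖b‖)) := by ring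
      _ ≤ ε * (2 * (‖a‖ ^ 2 + ‖b‖ ^ 2)) := by gcongr
      _ = (2 * ε * (‖a‖ ^ 2 + ‖b‖ ^ 2)) * 1 := by ring
      _ ≤ (2 * ε * (‖a‖ ^ 2 + ‖b‖ ^ 2)) * ℓ := by gcongr
      _ = _ := by ring
  have f2 : ℓ * ‖a‖ * (ε * (‖a‖ + ‖b‖)) + ℓ * ‖b‖ * (ε * (‖a‖ + ‖b‖)) ≤
      2 * ε * ℓ * (‖a‖ ^ 2 + ‖b‖ ^ 2) := by
    have : (‖a‖ + ‖b‖) ^ 2 ≤ 2 * (‖a‖ ^ 2 + ‖b‖ ^ 2) := by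
      nlinarith [sq_nonneg (‖a‖ - ‖b‖)]
    calc _ = ℓ * ε * (‖a‖ + ‖b‖) ^ 2 := by ring
      _ ≤ ℓ * ε * (2 * (‖a‖ ^ 2 + ‖b‖ ^ 2)) := by gcongr
      _ = _ := by ring
  have f3 : 0 < ℓ * ε := by positivity
  nlinarith

lemma corr_mem (hΦ : IsRegularDomain n Φ δ₀) {x y V : H1Curve n 0 1} (hx : MemMf Φ x)
    (hy : MemMf Φ y)
    (hV : ∀ s, V.toFun s = (y.toFun s - x.toFun s) - Pm Φ (x.toFun s, y.toFun s)) :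
    MemVminus Φ x V := by
  refine ⟨?_, ?_, fun s hs h0 => ?_⟩
  · rw [hV, inner_corr hΦ _ _ hx.2.1, hy.2.1]
  · rw [hV, inner_corr hΦ _ _ hx.2.2, hy.2.2]
  · rw [hV, inner_corr hΦ _ _ h0]
    exact hy.1 s (Ioo_subset_Icc_self hs)

lemma corr_norm {x y V : H1Curve n 0 1} {ε M : ℝ} (hε1 : ε ≤ 1)
    (hV : ∀ s, V.toFun s = (y.toFun s - x.toFun s) - Pm Φ (x.toFun s, y.toFun s))
    (hV' : ∀ s, V.deriv s = (y.deriv s - x.deriv s) -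
        fderiv ℝ (Pm Φ) (x.toFun s, y.toFun s) (x.deriv s, y.deriv s))
    (hxy : ∀ s ∈ Icc (0:ℝ) 1, ‖x.toFun s - y.toFun s‖ ≤ ε)
    (hP : ∀ s ∈ Icc (0:ℝ) 1, ‖Pm Φ (x.toFun s, y.toFun s)‖ ≤ ε)
    (hD : ∀ s ∈ Icc (0:ℝ) 1, ‖fderiv ℝ (Pm Φ) (x.toFun s, y.toFun s)‖ ≤ ε)
    (hMx : ∫ s, ‖x.deriv s‖ ^ 2 ∂muI ≤ M) (hMy : ∫ s, ‖y.deriv s‖ ^ 2 ∂muI ≤ M) :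
    starNorm V ≤ 2 + Real.sqrt (16 * M) := by
  have h1 : ∀ s ∈ Icc (0:ℝ) 1, ‖V.toFun s‖ ≤ 2 := by
    intro s hs
    rw [hV]
    refine (norm_sub_le _ _).trans ?_
    rw [norm_sub_rev]
    linarith [hxy s hs, hP s hs]
  unfold starNorm
  refine add_le_add (max_le (h1 0 (by simp)) (h1 1 (by simp))) (Real.sqrt_le_sqrt ?_)
  rw [int01]
  have h2 : ∫ s, ‖V.deriv s‖ ^ 2 ∂muI ≤ ∫ s, 8 * (‖x.deriv s‖ ^ 2 + ‖y.deriv s‖ ^ 2) ∂muI := by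
    refine integral_mono_ae V.sq_intble ((x.sq_intble.add y.sq_intble).const_mul 8) ?_
    filter_upwards [ae_memI] with s hs
    have nab : ‖(x.deriv s, y.deriv s)‖ ≤ ‖x.deriv s‖ + ‖y.deriv s‖ := by
      rw [Prod.norm_def]; exact max_le (by simp) (by simp)
    have h3 : ‖V.deriv s‖ ≤ 2 * (‖x.deriv s‖ + ‖y.deriv s‖) := by
      rw [hV']
      refine (norm_sub_le _ _).trans ?_
      have k1 := norm_sub_le (y.deriv s) (x.deriv s)
      have k2 : ‖fderiv ℝ (Pm Φ) (x.toFun s, y.toFun s) (x.deriv s, y.deriv s)‖ ≤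
          1 * (‖x.deriv s‖ + ‖y.deriv s‖) := by
        refine (ContinuousLinearMap.le_opNorm _ _).trans ?_
        gcongr
        exact (hD s hs).trans hε1
      linarith
    calc ‖V.deriv s‖ ^ 2 ≤ (2 * (‖x.deriv s‖ + ‖y.deriv s‖)) ^ 2 := by gcongr
      _ ≤ _ := by nlinarith [sq_nonneg (‖x.deriv s‖ - ‖y.deriv s‖)]
  rw [integral_const_mul, integral_add x.sq_intble y.sq_intble] at h2
  linarith

lemma pair_est (hG : IsFinslerEnergy n G ℓ α) (hΦ : IsRegularDomain n Φ δ₀)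
    {M : ℝ} {ε : ℝ} (hε : 0 < ε) (hε1 : ε ≤ 1) :
    ∃ δ > 0, ∀ (x y : H1Curve n 0 1) (e₁ e₂ : ℝ), MemMf Φ x → MemMf Φ y → 0 ≤ e₁ → 0 ≤ e₂ →
      (∀ V : H1Curve n 0 1, MemVminus Φ x V → starNorm V = 1 → -e₁ ≤ dJ G x V) →
      (∀ V : H1Curve n 0 1, MemVminus Φ y V → starNorm V = 1 → -e₂ ≤ dJ G y V) →
      ∫ s, ‖x.deriv s‖ ^ 2 ∂muI ≤ M → ∫ s, ‖y.deriv s‖ ^ 2 ∂muI ≤ M →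
      (∀ s ∈ Icc (0:ℝ) 1, dist (x.toFun s) (y.toFun s) < δ) →
      α * ∫ s, ‖x.deriv s - y.deriv s‖ ^ 2 ∂muI ≤
        8 * ℓ * ε * (1 + 2 * M) + 2 * (e₁ + e₂) * (2 + Real.sqrt (16 * M)) := by
  have hK : IsCompact (Φ ⁻¹' Iic 0) := hΦ.sublevel_compact 0 ⟨le_rfl, hΦ.delta0_pos.le⟩
  obtain ⟨δ₁, hδ₁, h1⟩ := dv_unif hG hK hε
  obtain ⟨δ₂, hδ₂, h2⟩ := Pm_unif hΦ hK hε
  refine ⟨min ε (min δ₁ δ₂), lt_min hε (lt_min hδ₁ hδ₂), ?_⟩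
  intro x y e₁ e₂ hx hy he₁ he₂ hpx hpy hMx hMy hd
  have hl : 0 < ℓ := lt_of_lt_of_le one_pos hG.one_le_ell
  obtain ⟨V, hV, hV'⟩ := exists_corrected hΦ x y
  obtain ⟨W, hW, hW'⟩ := exists_corrected hΦ y x
  have d0 : ∀ s ∈ Icc (0:ℝ) 1, ‖x.toFun s - y.toFun s‖ ≤ ε := fun s hs => by
    rw [← dist_eq_norm]; exact ((hd s hs).trans_le (min_le_left _ _)).le
  have d1 : ∀ s ∈ Icc (0:ℝ) 1, dist (x.toFun s) (y.toFun s) < δ₁ := fun s hs =>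
    (hd s hs).trans_le ((min_le_right _ _).trans (min_le_left _ _))
  have d2 : ∀ s ∈ Icc (0:ℝ) 1, dist (x.toFun s) (y.toFun s) < δ₂ := fun s hs =>
    (hd s hs).trans_le ((min_le_right _ _).trans (min_le_right _ _))
  have q1 := fun s hs => h2 _ (hx.1 s hs) _ (hy.1 s hs) (d2 s hs)
  have q2 := fun s hs => h2 _ (hy.1 s hs) _ (hx.1 s hs) (by rw [dist_comm]; exact d2 s hs)
  have nV := corr_norm hε1 hV hV' d0 (fun s hs => (q1 s hs).1) (fun s hs => (q1 s hs).2) hMx hMy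
  have nW := corr_norm hε1 hW hW' (fun s hs => by rw [norm_sub_rev]; exact d0 s hs)
    (fun s hs => (q2 s hs).1) (fun s hs => (q2 s hs).2) hMy hMx
  have pV := ps_scaled x hpx V (corr_mem hΦ hx hy hV)
  have pW := ps_scaled y hpy W (corr_mem hΦ hy hx hW)
  have sq_sub : Integrable (fun s => ‖x.deriv s - y.deriv s‖ ^ 2) muI :=
    (memLp_two_iff_integrable_sq_norm (x.intble.sub y.intble).1).1 (x.memLp.sub y.memLp)
  have i1 : Integrable (fun s => 1 + ‖x.deriv s‖ ^ 2) muI :=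
    (integrable_const (1:ℝ)).add x.sq_intble
  have i0 : Integrable (fun s => 1 + ‖x.deriv s‖ ^ 2 + ‖y.deriv s‖ ^ 2) muI :=
    ((integrable_const (1:ℝ)).add x.sq_intble).add y.sq_intble
  have hIneq : ∫ s, ((dqCLM G (x.toFun s) (x.deriv s) (V.toFun s) +
      dvCLM G (x.toFun s) (x.deriv s) (V.deriv s)) +
      (dqCLM G (y.toFun s) (y.deriv s) (W.toFun s) +
      dvCLM G (y.toFun s) (y.deriv s) (W.deriv s))) ∂muI ≤
      ∫ s, (8 * ℓ * ε * (1 + ‖x.deriv s‖ ^ 2 + ‖y.deriv s‖ ^ 2) -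
        α * ‖x.deriv s - y.deriv s‖ ^ 2) ∂muI := by
    refine integral_mono_ae ((dJ_intble hG x V).add (dJ_intble hG y W))
      ((i0.const_mul _).sub (sq_sub.const_mul _)) ?_
    filter_upwards [ae_memI] with s hs
    simp only [hV, hV', hW, hW']
    exact pointwise_est hG hε _ _ _ _ _ _ _ _ (d0 s hs) (q1 s hs).1 (q2 s hs).1 (q1 s hs).2
      (q2 s hs).2 (h1 _ (hx.1 s hs) _ (hy.1 s hs) (d1 s hs) _)
  rw [integral_add (dJ_intble hG x V) (dJ_intble hG y W),
    integral_sub (i0.const_mul _) (sq_sub.const_mul _), integral_const_mul, integral_const_mul,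
    integral_add i1 y.sq_intble,
    integral_add (integrable_const (1:ℝ)) x.sq_intble] at hIneq
  have hone : ∫ _s, (1:ℝ) ∂muI = 1 := by simp
  rw [hone] at hIneq
  unfold dJ at pV pW
  rw [int01] at pV pW
  have m1 : e₁ * starNorm V ≤ e₁ * (2 + Real.sqrt (16 * M)) := by gcongr
  have m2 : e₂ * starNorm W ≤ e₂ * (2 + Real.sqrt (16 * M)) := by gcongr
  have m3 : 8 * ℓ * ε * (1 + ∫ s, ‖x.deriv s‖ ^ 2 ∂muI + ∫ s, ‖y.deriv s‖ ^ 2 ∂muI) ≤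
      8 * ℓ * ε * (1 + 2 * M) :=
    mul_le_mul_of_nonneg_left (by linarith) (by positivity)
  linarith

end Main

/-! ### Compactness -/

section Compactness

variable {n : ℕ} {G : Evec n → Evec n → ℝ} {ℓ α : ℝ} {Φ : Evec n → ℝ} {δ₀ : ℝ}

lemma norm_int_le {u : ℝ → Evec n} (hu : Integrable (fun s => ‖u s‖ ^ 2) muI) {a b lam : ℝ}
    (ha : 0 ≤ a) (hab : a ≤ b) (hb : b ≤ 1) (hl : 0 < lam) :
    ‖∫ s in a..b, u s‖ ≤ lam * (b - a) + (∫ s, ‖u s‖ ^ 2 ∂muI) / lam := by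
  have hsub : Ioc a b ⊆ Icc (0:ℝ) 1 := fun s hs => ⟨ha.trans hs.1.le, hs.2.trans hb⟩
  have hi : IntervalIntegrable (fun s => ‖u s‖ ^ 2) volume a b := by
    rw [intervalIntegrable_iff_integrableOn_Ioc_of_le hab]
    exact IntegrableOn.mono_set hu hsub
  have hg : IntervalIntegrable (fun s => lam + ‖u s‖ ^ 2 / lam) volume a b :=
    intervalIntegrable_const.add (hi.div_const lam)
  have h1 : ‖∫ s in a..b, u s‖ ≤ ∫ s in a..b, (lam + ‖u s‖ ^ 2 / lam) := by
    refine intervalIntegral.norm_integral_le_of_norm_le hab ?_ hg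
    refine Eventually.of_forall fun s _ => ?_
    have : lam + ‖u s‖ ^ 2 / lam = (lam ^ 2 + ‖u s‖ ^ 2) / lam := by field_simp
    rw [this, le_div_iff₀ hl]
    nlinarith [sq_nonneg (lam - ‖u s‖), norm_nonneg (u s)]
  rw [intervalIntegral.integral_add intervalIntegrable_const (hi.div_const lam),
    intervalIntegral.integral_const, intervalIntegral.integral_div] at h1
  have h2 : ∫ s in a..b, ‖u s‖ ^ 2 ≤ ∫ s, ‖u s‖ ^ 2 ∂muI := by
    rw [intervalIntegral.integral_of_le hab]
    exact setIntegral_mono_set hu (Eventually.of_forall fun s => by positivity)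
      (Eventually.of_forall hsub)
  refine h1.trans ?_
  rw [smul_eq_mul, mul_comm (b - a)]
  gcongr

lemma curve_sub (x : H1Curve n 0 1) {a b : ℝ} (ha : a ∈ Icc (0:ℝ) 1) (hb : b ∈ Icc (0:ℝ) 1) :
    x.toFun b - x.toFun a = ∫ s in a..b, x.deriv s := by
  have hi := ii01 x.intble
  have h0 : (0:ℝ) ∈ uIcc (0:ℝ) 1 := by simp
  have ha1 : a ∈ uIcc (0:ℝ) 1 := by rwa [uIcc_of_le zero_le_one]
  have hb1 : b ∈ uIcc (0:ℝ) 1 := by rwa [uIcc_of_le zero_le_one]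
  have h1 := intervalIntegral.integral_interval_sub_left
    (hi.mono_set (uIcc_subset_uIcc h0 hb1)) (hi.mono_set (uIcc_subset_uIcc h0 ha1))
  have e1 := x.eq_add_integral a ha
  have e2 := x.eq_add_integral b hb
  calc x.toFun b - x.toFun a = (x.toFun 0 + ∫ s in (0:ℝ)..b, x.deriv s) -
        (x.toFun 0 + ∫ s in (0:ℝ)..a, x.deriv s) := by rw [← e1, ← e2]
    _ = (∫ s in (0:ℝ)..b, x.deriv s) - ∫ s in (0:ℝ)..a, x.deriv s := by abel
    _ = _ := h1

lemma curve_mod {x : H1Curve n 0 1} {M lam : ℝ} (hM : ∫ s, ‖x.deriv s‖ ^ 2 ∂muI ≤ M)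
    (hl : 0 < lam) {a b : ℝ} (ha : a ∈ Icc (0:ℝ) 1) (hb : b ∈ Icc (0:ℝ) 1) :
    dist (x.toFun a) (x.toFun b) ≤ lam * dist a b + M / lam := by
  wlog hab : a ≤ b generalizing a b
  · rw [dist_comm, dist_comm a b]
    exact this hb ha (le_of_not_ge hab)
  rw [dist_comm, dist_eq_norm, curve_sub x ha hb, dist_comm, Real.dist_eq,
    abs_of_nonneg (sub_nonneg.2 hab)]
  refine (norm_int_le x.sq_intble ha.1 hab hb.2 hl).trans ?_
  gcongr

lemma ascoli_subseq {K : Set (Evec n)} (hK : IsCompact K) {M : ℝ} (hM0 : 0 ≤ M)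
    (x : ℕ → H1Curve n 0 1)
    (hxK : ∀ m, ∀ s ∈ Icc (0:ℝ) 1, (x m).toFun s ∈ K)
    (hM : ∀ m, ∫ s, ‖(x m).deriv s‖ ^ 2 ∂muI ≤ M) :
    ∃ φ : ℕ → ℕ, StrictMono φ ∧ ∃ p₀ : Evec n,
      Tendsto (fun k => (x (φ k)).toFun 0) atTop (nhds p₀) ∧
      ∀ δ > 0, ∃ N, ∀ i ≥ N, ∀ j ≥ N, ∀ s ∈ Icc (0:ℝ) 1,
        dist ((x (φ i)).toFun s) ((x (φ j)).toFun s) < δ := by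
  let f : ℕ → BoundedContinuousFunction (Icc (0:ℝ) 1) (Evec n) := fun m =>
    BoundedContinuousFunction.mkOfCompact
      ⟨(Icc (0:ℝ) 1).domRestrict (x m).toFun, (x m).contOn.domRestrict⟩
  have hf : ∀ m (s : Icc (0:ℝ) 1), f m s = (x m).toFun s := fun m s => rfl
  have hcomp : IsCompact (closure (range f)) := by
    refine BoundedContinuousFunction.arzela_ascoli K hK (range f) ?_ ?_
    · rintro _ s ⟨m, rfl⟩
      exact hxK m s s.2
    · intro s₀
      rw [Metric.equicontinuousAt_iff]
      intro ε hε
      have hl : 0 < (2 * M + 1) / ε := by positivity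
      refine ⟨ε / (2 * ((2 * M + 1) / ε)), by positivity, fun s hs => ?_⟩
      rintro ⟨_, m, rfl⟩
      refine lt_of_le_of_lt (curve_mod (hM m) hl s₀.2 s.2) ?_
      have h1 : (2 * M + 1) / ε * dist (s₀ : ℝ) s < ε / 2 := by
        have : dist (s₀ : ℝ) s < ε / (2 * ((2 * M + 1) / ε)) := by
          rw [dist_comm]; exact hs
        calc _ < (2 * M + 1) / ε * (ε / (2 * ((2 * M + 1) / ε))) := by gcongr
          _ = _ := by field_simp
      have h2 : M / ((2 * M + 1) / ε) ≤ ε / 2 := by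
        rw [div_div_eq_mul_div, div_le_div_iff₀ (by positivity) (by norm_num)]
        nlinarith
      linarith
  obtain ⟨g, -, φ, hφ, hlim⟩ := hcomp.tendsto_subseq (x := f) fun m =>
    subset_closure (mem_range_self m)
  have h0 : (0:ℝ) ∈ Icc (0:ℝ) 1 := by simp
  refine ⟨φ, hφ, g ⟨0, h0⟩, ?_, ?_⟩
  · have hc : Continuous fun F : BoundedContinuousFunction (Icc (0:ℝ) 1) (Evec n) => F ⟨0, h0⟩ :=
      by fun_prop
    exact (hc.tendsto g).comp hlim
  · intro δ hδ
    obtain ⟨N, hN⟩ := Metric.cauchySeq_iff.1 hlim.cauchySeq δ hδ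
    refine ⟨N, fun i hi j hj s hs => ?_⟩
    exact lt_of_le_of_lt (BoundedContinuousFunction.dist_coe_le_dist (f := f (φ i))
      (g := f (φ j)) (⟨s, hs⟩ : Icc (0:ℝ) 1)) (hN i hi j hj)

lemma norm_toLp_sq {u : ℝ → Evec n} (hu : MemLp u 2 muI) :
    ‖hu.toLp u‖ ^ 2 = ∫ s, ‖u s‖ ^ 2 ∂muI := by
  rw [← real_inner_self_eq_norm_sq, L2.inner_def]
  refine integral_congr_ae ?_
  filter_upwards [hu.coeFn_toLp] with s hs
  rw [hs, real_inner_self_eq_norm_sq]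

lemma l2_complete {u : ℕ → ℝ → Evec n} (hu : ∀ k, MemLp (u k) 2 muI)
    (hc : ∀ η > 0, ∃ N, ∀ i ≥ N, ∀ j ≥ N, ∫ s, ‖u i s - u j s‖ ^ 2 ∂muI < η) :
    ∃ v : ℝ → Evec n, MemLp v 2 muI ∧
      Tendsto (fun k => ∫ s, ‖u k s - v s‖ ^ 2 ∂muI) atTop (nhds 0) := by
  have hcs : CauchySeq fun k => (hu k).toLp (u k) := by
    rw [Metric.cauchySeq_iff]
    intro ε hε
    obtain ⟨N, hN⟩ := hc (ε ^ 2) (by positivity)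
    refine ⟨N, fun i hi j hj => ?_⟩
    rw [dist_eq_norm, ← MemLp.toLp_sub]
    refine lt_of_pow_lt_pow_left₀ 2 hε.le ?_
    rw [norm_toLp_sq]
    exact hN i hi j hj
  obtain ⟨v, hv⟩ := cauchySeq_tendsto_of_complete hcs
  refine ⟨v, Lp.memLp v, ?_⟩
  have h1 : Tendsto (fun k => ‖(hu k).toLp (u k) - v‖ ^ 2) atTop (nhds 0) := by
    have := (tendsto_iff_norm_sub_tendsto_zero.1 hv).pow 2
    simpa using this
  refine h1.congr fun k => ?_
  have : (hu k).toLp (u k) - v = ((hu k).sub (Lp.memLp v)).toLp (u k - ⇑v) := by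
    rw [MemLp.toLp_sub (hu k) (Lp.memLp v), Lp.toLp_coeFn v (Lp.memLp v)]
  rw [this, norm_toLp_sq]
  rfl

lemma limit_curve {u : ℕ → H1Curve n 0 1} {p₀ : Evec n} {v : ℝ → Evec n} (hv : MemLp v 2 muI)
    (h0 : Tendsto (fun k => (u k).toFun 0) atTop (nhds p₀))
    (hE : Tendsto (fun k => ∫ s, ‖(u k).deriv s - v s‖ ^ 2 ∂muI) atTop (nhds 0)) :
    ∃ y : H1Curve n 0 1, y.deriv = v ∧
      TendstoUniformlyOn (fun k s => (u k).toFun s) y.toFun atTop (Icc (0:ℝ) 1) := by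
  have hvi : Integrable v muI := hv.integrable (by norm_num)
  have hv2 : Integrable (fun s => ‖v s‖ ^ 2) muI :=
    (memLp_two_iff_integrable_sq_norm hvi.1).1 hv
  refine ⟨⟨fun t => p₀ + ∫ s in (0:ℝ)..t, v s, v, hvi, hv2, fun t _ => by simp⟩, rfl, ?_⟩
  rw [Metric.tendstoUniformlyOn_iff]
  intro ε hε
  have e1 : ∀ᶠ k in atTop, dist ((u k).toFun 0) p₀ < ε / 3 :=
    Metric.tendsto_nhds.1 h0 _ (by positivity)
  have e2 : ∀ᶠ k in atTop, ∫ s, ‖(u k).deriv s - v s‖ ^ 2 ∂muI < (ε / 3) * (ε / 3) :=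
    hE.eventually (gt_mem_nhds (by positivity))
  filter_upwards [e1, e2] with k k1 k2 t ht
  have sq_sub : Integrable (fun s => ‖(u k).deriv s - v s‖ ^ 2) muI :=
    (memLp_two_iff_integrable_sq_norm ((u k).intble.sub hvi).1).1 ((u k).memLp.sub hv)
  have h1 := norm_int_le sq_sub le_rfl ht.1 ht.2 (lam := ε / 3) (by positivity)
  have hs : uIcc (0:ℝ) t ⊆ uIcc 0 1 := by
    refine uIcc_subset_uIcc (by simp) ?_
    rwa [uIcc_of_le zero_le_one]
  rw [intervalIntegral.integral_sub ((ii01 (u k).intble).mono_set hs)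
    ((ii01 hvi).mono_set hs)] at h1
  have h2 : (∫ s, ‖(u k).deriv s - v s‖ ^ 2 ∂muI) / (ε / 3) < ε / 3 := by
    rw [div_lt_iff₀ (by positivity)]; exact k2
  have h3 : ε / 3 * (t - 0) ≤ ε / 3 * 1 := by
    gcongr
    linarith [ht.2]
  have h4 : (u k).toFun t - (p₀ + ∫ s in (0:ℝ)..t, v s) =
      ((u k).toFun 0 - p₀) + ((∫ s in (0:ℝ)..t, (u k).deriv s) - ∫ s in (0:ℝ)..t, v s) := by
    have := (u k).eq_add_integral t ht
    calc _ = ((u k).toFun 0 + ∫ s in (0:ℝ)..t, (u k).deriv s) -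
          (p₀ + ∫ s in (0:ℝ)..t, v s) := by rw [← this]
      _ = _ := by abel
  rw [dist_comm, dist_eq_norm]
  refine lt_of_le_of_lt (le_of_eq (congrArg norm h4)) ?_
  refine lt_of_le_of_lt (norm_add_le _ _) ?_
  rw [dist_eq_norm] at k1
  linarith

lemma mem_limit (hΦ : IsRegularDomain n Φ δ₀) {u : ℕ → H1Curve n 0 1} {y : H1Curve n 0 1}
    (hu : ∀ k, MemMf Φ (u k))
    (h : TendstoUniformlyOn (fun k s => (u k).toFun s) y.toFun atTop (Icc (0:ℝ) 1)) :
    MemMf Φ y := by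
  have hp : ∀ s ∈ Icc (0:ℝ) 1, Tendsto (fun k => Φ ((u k).toFun s)) atTop
      (nhds (Φ (y.toFun s))) := fun s hs =>
    (hΦ.smooth.continuous.tendsto _).comp (h.tendsto_at hs)
  refine ⟨fun s hs => le_of_tendsto' (hp s hs) fun k => (hu k).1 s hs, ?_, ?_⟩
  · exact tendsto_nhds_unique (hp 0 (by simp))
      (tendsto_const_nhds.congr fun k => ((hu k).2.1).symm)
  · exact tendsto_nhds_unique (hp 1 (by simp))
      (tendsto_const_nhds.congr fun k => ((hu k).2.2).symm)

end Compactness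

/-- Palais–Smale condition: every `V⁻`-Palais–Smale sequence for `J` on `Mf` at level `c`
has a subsequence converging strongly in `H¹` to some `x ∈ Mf`. -/
theorem stmt_13 {n : ℕ} (G : Evec n → Evec n → ℝ) (ℓ α : ℝ)
    (hG : IsFinslerEnergy n G ℓ α)
    (Φ : Evec n → ℝ) (δ₀ : ℝ) (hΦ : IsRegularDomain n Φ δ₀)
    (c : ℝ) (x : ℕ → H1Curve n 0 1)
    (hMf : ∀ m : ℕ, MemMf Φ (x m))
    (hJ : Tendsto (fun m => energy G (x m)) atTop (nhds c))
    (eps : ℕ → ℝ) (hepspos : ∀ m, 0 < eps m) (heps : Tendsto eps atTop (nhds 0))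
    (hPS : ∀ m : ℕ, ∀ V : H1Curve n 0 1, MemVminus Φ (x m) V → starNorm V = 1 →
      -(eps m) ≤ dJ G (x m) V) :
    ∃ φ : ℕ → ℕ, StrictMono φ ∧
      ∃ xlim : H1Curve n 0 1, MemMf Φ xlim ∧
        TendstoUniformlyOn (fun k s => (x (φ k)).toFun s) xlim.toFun atTop (Icc (0:ℝ) 1) ∧
        Tendsto (fun k => ∫ s in (0:ℝ)..1, ‖(x (φ k)).deriv s - xlim.deriv s‖ ^ 2)
          atTop (nhds 0) := by
  obtain ⟨B, hB⟩ := hJ.bddAbove_range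
  have hl : 0 < ℓ := lt_of_lt_of_le one_pos hG.one_le_ell
  have hα := hG.alpha_pos
  have hM : ∀ m, ∫ s, ‖(x m).deriv s‖ ^ 2 ∂muI ≤ 2 * ℓ * B := fun m =>
    (energy_bound hG (x m)).trans (by
      have := hB (mem_range_self m)
      gcongr)
  obtain ⟨M, hMdef⟩ : ∃ M, M = 2 * ℓ * B := ⟨_, rfl⟩
  rw [← hMdef] at hM
  have hM0 : 0 ≤ M := (integral_nonneg fun s => by positivity).trans (hM 0)
  have hK : IsCompact (Φ ⁻¹' Iic 0) := hΦ.sublevel_compact 0 ⟨le_rfl, hΦ.delta0_pos.le⟩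
  obtain ⟨φ, hφ, p₀, hp₀, hunif⟩ := ascoli_subseq hK hM0 x (fun m s hs => (hMf m).1 s hs) hM
  have hcau : ∀ η > 0, ∃ N, ∀ i ≥ N, ∀ j ≥ N,
      ∫ s, ‖(x (φ i)).deriv s - (x (φ j)).deriv s‖ ^ 2 ∂muI < η := by
    intro η hη
    have hA : 0 < 8 * ℓ * (1 + 2 * M) := by positivity
    have hC : 0 < 2 + Real.sqrt (16 * M) := by positivity
    obtain ⟨ε, hεdef⟩ : ∃ ε, ε = min 1 (α * η / (4 * (8 * ℓ * (1 + 2 * M)))) := ⟨_, rfl⟩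
    have hε : 0 < ε := by rw [hεdef]; exact lt_min one_pos (by positivity)
    have hε1 : ε ≤ 1 := by rw [hεdef]; exact min_le_left _ _
    have hε2 : ε * (8 * ℓ * (1 + 2 * M)) ≤ α * η / 4 := by
      have : ε ≤ α * η / (4 * (8 * ℓ * (1 + 2 * M))) := by rw [hεdef]; exact min_le_right _ _
      rw [le_div_iff₀ (by positivity)] at this
      linarith
    obtain ⟨δ, hδ, hest⟩ := pair_est hG hΦ (M := M) hε hε1
    obtain ⟨N₁, hN₁⟩ := hunif δ hδ
    have hev : ∀ᶠ k in atTop, eps (φ k) < α * η / (8 * (2 + Real.sqrt (16 * M))) :=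
      (heps.comp hφ.tendsto_atTop).eventually (gt_mem_nhds (by positivity))
    obtain ⟨N₂, hN₂⟩ := eventually_atTop.1 hev
    refine ⟨max N₁ N₂, fun i hi j hj => ?_⟩
    have h1 := hest (x (φ i)) (x (φ j)) (eps (φ i)) (eps (φ j)) (hMf _) (hMf _)
      (hepspos _).le (hepspos _).le (hPS _) (hPS _) (hM _) (hM _)
      (hN₁ i (le_of_max_le_left hi) j (le_of_max_le_left hj))
    have h2 := hN₂ i (le_of_max_le_right hi)
    have h3 := hN₂ j (le_of_max_le_right hj)
    rw [lt_div_iff₀ (by positivity)] at h2 h3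
    have h4 : α * ∫ s, ‖(x (φ i)).deriv s - (x (φ j)).deriv s‖ ^ 2 ∂muI < α * η := by
      have : 0 < α * η := by positivity
      nlinarith
    exact lt_of_mul_lt_mul_left h4 hα.le
  obtain ⟨v, hv, hE⟩ := l2_complete (fun k => (x (φ k)).memLp) hcau
  obtain ⟨y, hy, hyu⟩ := limit_curve (u := fun k => x (φ k)) hv hp₀ hE
  refine ⟨φ, hφ, y, mem_limit hΦ (fun k => hMf (φ k)) hyu, hyu, ?_⟩
  simp only [int01, hy]
  exact hE

end
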